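/- arXiv:1907.13032 — 3 statements merged into one kernel-verified Lean document; each statement's English description precedes it below -/
import Mathlib

section
/- Let q = 3^m with m ≥ 3 odd, and let Tr : GF(q) → GF(3) be the trace. For every x ∈ GF(q), the sum over a ∈ GF(q)* of (Tr(a^2 x^2))^2 equals 0 in GF(3). -/
open Finset

/-- A power sum over the nonzero elements of a finite field with `q` elements vanishes when
`q - 1` does not divide the exponent. -/
theorem sum_nonzero_pow_eq_zero {F : Type*} [Field F] [Fintype F] [DecidableEq F] {i : ℕ}
    (hi : ¬ Fintype.card F - 1 ∣ i) : ∑ a ∈ Finset.univ \ {(0 : F)}, a ^ i = 0 := by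
  let φ : Fˣ ↪ F := ⟨fun u ↦ u, Units.val_injective⟩
  have hφ : Finset.univ.map φ = Finset.univ \ {(0 : F)} := by
    ext a
    simpa only [mem_map, mem_univ, Function.Embedding.coeFn_mk, true_and, mem_sdiff,
      mem_singleton, φ] using! isUnit_iff_ne_zero
  rw [← hφ, Finset.sum_map]
  exact (FiniteField.sum_pow_units F i).trans (if_neg hi)

theorem not_three_pow_sub_one_dvd {m i j : ℕ} (hm : 2 ≤ m) (hmodd : Odd m)
    (hi : i < m) (hj : j < m) : ¬ 3 ^ m - 1 ∣ 2 * (3 ^ i + 3 ^ j) := by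
  rintro ⟨c, hc⟩
  obtain ⟨k, rfl⟩ : ∃ k, m = k + 1 := ⟨m - 1, by omega⟩
  have hik : 3 ^ i ≤ 3 ^ k := Nat.pow_le_pow_right (by norm_num) (by omega)
  have hjk : 3 ^ j ≤ 3 ^ k := Nat.pow_le_pow_right (by norm_num) (by omega)
  have hk : 3 ^ 1 ≤ 3 ^ k := Nat.pow_le_pow_right (by norm_num) (by omega)
  have hipos : 0 < 3 ^ i := by positivity
  have hiodd : 3 ^ i % 2 = 1 := Nat.odd_iff.mp (Odd.pow (by decide))
  have hjodd : 3 ^ j % 2 = 1 := Nat.odd_iff.mp (Odd.pow (by decide))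
  have hmod : 3 ^ (k + 1) % 4 = 3 := by
    obtain ⟨l, hl⟩ := hmodd
    rw [hl, pow_succ, pow_mul, Nat.mul_mod, Nat.pow_mod]
    norm_num
  have hpow : 3 ^ (k + 1) = 3 * 3 ^ k := by ring
  have hc2 : c < 2 := by
    by_contra! h
    have := Nat.mul_le_mul_left (3 ^ (k + 1) - 1) h
    omega
  rw [hpow] at hc hmod
  generalize 3 ^ i = u at *
  generalize 3 ^ j = v at *
  generalize 3 ^ k = w at *
  interval_cases c <;> omega

/-- for `q = 3^m`, `m ≥ 3` odd, `∑_{a ∈ GF(q)*} Tr(a² x²)² = 0` in `GF(3)`. -/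
theorem sum_tr_sq_sq (m : ℕ) (hm : 3 ≤ m) (hmodd : Odd m)
    (F : Type) [Field F] [Fintype F] [DecidableEq F] [Algebra (ZMod 3) F]
    (hF : Fintype.card F = 3 ^ m) (x : F) :
    ∑ a ∈ Finset.univ \ {(0 : F)},
      (Algebra.trace (ZMod 3) F (a ^ 2 * x ^ 2)) ^ 2 = 0 := by
  have hrank : Module.finrank (ZMod 3) F = m := by
    have h := Module.card_eq_pow_finrank (K := ZMod 3) (V := F)
    rw [hF, ZMod.card] at h
    exact (Nat.pow_right_injective (by norm_num) h).symm
  apply FaithfulSMul.algebraMap_injective (ZMod 3) F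
  simp only [map_sum, map_pow, map_zero, FiniteField.algebraMap_trace_eq_sum_pow, hrank,
    Nat.card_zmod]
  simp_rw [sq (∑ _ ∈ Finset.range m, _), Finset.sum_mul_sum]
  rw [Finset.sum_comm]
  refine Finset.sum_eq_zero fun i hi ↦ ?_
  rw [Finset.sum_comm]
  refine Finset.sum_eq_zero fun j hj ↦ ?_
  have hterm (a : F) : (a ^ 2 * x ^ 2) ^ 3 ^ i * (a ^ 2 * x ^ 2) ^ 3 ^ j =
      a ^ (2 * (3 ^ i + 3 ^ j)) * x ^ (2 * (3 ^ i + 3 ^ j)) := by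
    rw [← pow_add, mul_pow, ← pow_mul, ← pow_mul]
  simp_rw [hterm, ← Finset.sum_mul]
  rw [sum_nonzero_pow_eq_zero, zero_mul]
  rw [hF]
  exact not_three_pow_sub_one_dvd (by omega) hmodd (Finset.mem_range.mp hi)
    (Finset.mem_range.mp hj)
end

section
/- Let q = 3^m with m ≥ 2. The GF(3)-linear span of the functions x ↦ Tr(a x^2)·Tr(b x^2) over all a, b ∈ GF(q) equals the set of functions x ↦ Σ_{j=0}^{m-1} Tr(c_j x^{2·3^j + 2}) with c_j ∈ GF(q). -/
open Finset

section

variable {m : ℕ} {F : Type} [Field F] [Fintype F] [Algebra (ZMod 3) F]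

lemma pow_three_pow_sum_smul {ι : Type*} (s : Finset ι) (r : ι → ZMod 3) (e : ι → F) (j : ℕ) :
    (∑ i ∈ s, r i • e i) ^ 3 ^ j = ∑ i ∈ s, r i • e i ^ 3 ^ j := by
  have : CharP F 3 := charP_of_injective_algebraMap (algebraMap (ZMod 3) F).injective 3
  have : ExpChar F 3 := .prime Nat.prime_three
  rw [sum_pow_char_pow]
  refine sum_congr rfl fun i _ => ?_
  rw [smul_pow, ZMod.pow_card_pow]

lemma exists_trace_dual_family :
    ∃ (n : ℕ) (e d : Fin n → F),
      ∀ x : F, x = ∑ i, Algebra.trace (ZMod 3) F (d i * x) • e i := by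
  let b := Module.finBasis (ZMod 3) F
  refine ⟨_, b.traceDual, b, fun x => ?_⟩
  conv_lhs => rw [← b.traceDual.sum_repr x]
  refine sum_congr rfl fun i _ => ?_
  rw [b.traceDual_repr_apply, Algebra.traceForm_apply, mul_comm]

/-- The product of the functionals `x ↦ Tr(a x)` and `x ↦ Tr(b x)` as a sum of traces of
Dembowski–Ostrom monomials. -/
lemma trace_mul_trace_eq_sum (hF : Fintype.card F = 3 ^ m) (a b x : F) :
    Algebra.trace (ZMod 3) F (a * x) * Algebra.trace (ZMod 3) F (b * x) =
      ∑ j : Fin m, Algebra.trace (ZMod 3) F (a * b ^ 3 ^ (j : ℕ) * x ^ (3 ^ (j : ℕ) + 1)) := by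
  have hm : Module.finrank (ZMod 3) F = m := by
    have h := Module.card_eq_pow_finrank (K := ZMod 3) (V := F)
    rw [hF, ZMod.card] at h
    exact (Nat.pow_right_injective (Nat.le_succ 2) h).symm
  rw [mul_comm, ← smul_eq_mul, ← map_smul, Algebra.smul_def,
    FiniteField.algebraMap_trace_eq_sum_pow, hm, Nat.card_zmod, sum_range, sum_mul, map_sum]
  refine sum_congr rfl fun j _ => congrArg _ ?_
  ring

end

/-- the `GF(3)`-span of the functions `x ↦ Tr(a x²)·Tr(b x²)` equals the
set of functions `x ↦ ∑_j Tr(c_j x^{2·3^j + 2})`. -/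
theorem span_tr_ax2_tr_bx2 (m : ℕ) (hm : 2 ≤ m)
    (F : Type) [Field F] [Fintype F] [Algebra (ZMod 3) F]
    (hF : Fintype.card F = 3 ^ m) :
    (Submodule.span (ZMod 3)
        {f : F → ZMod 3 | ∃ a b : F, f = fun x =>
          Algebra.trace (ZMod 3) F (a * x ^ 2) * Algebra.trace (ZMod 3) F (b * x ^ 2)} :
      Set (F → ZMod 3)) =
    {f : F → ZMod 3 | ∃ c : Fin m → F, f = fun x =>
      ∑ j : Fin m, Algebra.trace (ZMod 3) F (c j * x ^ (2 * 3 ^ (j : ℕ) + 2))} := by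
  have hpow (x : F) (j : ℕ) : x ^ (2 * 3 ^ j + 2) = (x ^ 2) ^ (3 ^ j + 1) := by
    rw [← pow_mul]; ring
  ext f
  constructor
  · intro hf
    induction hf using Submodule.span_induction with
    | mem f hf =>
      obtain ⟨a, b, rfl⟩ := hf
      refine ⟨fun j => a * b ^ 3 ^ (j : ℕ), funext fun x => ?_⟩
      simp only [hpow, trace_mul_trace_eq_sum hF]
    | zero => exact ⟨0, by ext; simp⟩
    | add f g _ _ hf hg =>
      obtain ⟨c, rfl⟩ := hf
      obtain ⟨d, rfl⟩ := hg
      exact ⟨c + d, by ext; simp [add_mul, sum_add_distrib]⟩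
    | smul r f _ hf =>
      obtain ⟨c, rfl⟩ := hf
      exact ⟨r • c, by ext; simp [mul_sum]⟩
  · rintro ⟨c, rfl⟩
    obtain ⟨n, e, d, hed⟩ := exists_trace_dual_family (F := F)
    have key : (fun x => ∑ j : Fin m,
        Algebra.trace (ZMod 3) F (c j * x ^ (2 * 3 ^ (j : ℕ) + 2))) =
        ∑ j : Fin m, ∑ i, fun x => Algebra.trace (ZMod 3) F (d i * x ^ 2) *
          Algebra.trace (ZMod 3) F (c j * e i ^ 3 ^ (j : ℕ) * x ^ 2) := by
      ext x
      simp only [Finset.sum_apply]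
      refine sum_congr rfl fun j _ => ?_
      rw [hpow, pow_succ]
      nth_rewrite 1 [hed (x ^ 2)]
      rw [pow_three_pow_sum_smul, sum_mul, mul_sum, map_sum]
      refine sum_congr rfl fun i _ => ?_
      rw [smul_mul_assoc, mul_smul_comm, map_smul, smul_eq_mul, mul_assoc]
    rw [key]
    exact Submodule.sum_mem _ fun j _ => Submodule.sum_mem _ fun i _ =>
      Submodule.subset_span ⟨_, _, rfl⟩
end

section
/- Let m ≥ 5 be odd. The dimension over GF(3) of the code C₃(D_d(C(m,3))) spanned by the incidence matrix of the design of minimum-weight supports of C(m,3) equals 2m² + 1; equivalently, the 3-rank of the incidence matrix of the 2-design D_d(C(m,3)) is 2m² + 1. -/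
open Finset

section TraceCounting

variable {F : Type} [Field F] [Fintype F] [DecidableEq F] [Algebra (ZMod 3) F]

omit [DecidableEq F] in
theorem card_trace_fiber {m : ℕ} (hF : Fintype.card F = 3 ^ (m + 1)) (c : ZMod 3) :
    #{x : F | Algebra.trace (ZMod 3) F x = c} = 3 ^ m := by
  have hsurj := Algebra.trace_surjective (ZMod 3) F
  have hconst (d : ZMod 3) : #{x : F | Algebra.trace (ZMod 3) F x = d} =
      #{x : F | Algebra.trace (ZMod 3) F x = c} :=
    AddMonoidHom.card_fiber_eq_of_mem_range (Algebra.trace (ZMod 3) F) (hsurj d) (hsurj c)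
  have htotal := card_eq_sum_card_fiberwise (s := univ) (t := univ)
    (f := fun x : F => Algebra.trace (ZMod 3) F x) (by simp)
  simp only [hconst, sum_const, card_univ, hF, ZMod.card, smul_eq_mul] at htotal
  rw [pow_succ] at htotal
  omega

omit [DecidableEq F] in
theorem card_trace_mul_eq_zero {m : ℕ} (hF : Fintype.card F = 3 ^ (m + 1)) {u : F} (hu : u ≠ 0) :
    #{v : F | Algebra.trace (ZMod 3) F (u * v) = 0} = 3 ^ m := by
  rw [← card_trace_fiber hF 0]
  exact card_equiv (Equiv.mulLeft₀ u hu) (by simp)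

omit [Fintype F] [DecidableEq F] in
theorem charP_three : CharP F 3 := (Algebra.charP_iff (ZMod 3) F 3).1 inferInstance

/-- Pairs of squares with equal traces are counted by `u * v` of trace zero, through
`u = y - z`, `v = y + z`. -/
theorem card_trace_sq_eq_trace_sq {m : ℕ} (hF : Fintype.card F = 3 ^ (m + 1)) :
    #{p : F × F | Algebra.trace (ZMod 3) F (p.1 ^ 2) = Algebra.trace (ZMod 3) F (p.2 ^ 2)} =
      3 * 3 ^ m + (3 * 3 ^ m - 1) * 3 ^ m := by
  have := charP_three (F := F)
  have h3 : (3 : F) = 0 := by exact_mod_cast CharP.cast_eq_zero F 3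
  let e : F × F ≃ F × F :=
    { toFun := fun p => (p.1 - p.2, p.1 + p.2)
      invFun := fun p => (-p.1 - p.2, p.1 - p.2)
      left_inv := fun p => by
        ext
        · simp only; linear_combination (-p.1) * h3
        · simp only; linear_combination (-p.2) * h3
      right_inv := fun p => by
        ext
        · simp only; linear_combination (-p.1) * h3
        · simp only; linear_combination (-p.2) * h3 }
  have hcard : #{p : F × F | Algebra.trace (ZMod 3) F (p.1 ^ 2) =
      Algebra.trace (ZMod 3) F (p.2 ^ 2)} =
      #{p : F × F | Algebra.trace (ZMod 3) F (p.1 * p.2) = 0} := by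
    refine card_equiv e fun p => ?_
    have : (p.1 - p.2) * (p.1 + p.2) = p.1 ^ 2 - p.2 ^ 2 := by ring
    simp [e, this, sub_eq_zero]
  have hsum : #{p : F × F | Algebra.trace (ZMod 3) F (p.1 * p.2) = 0} =
      ∑ u : F, #{v : F | Algebra.trace (ZMod 3) F (u * v) = 0} := by
    simp only [card_filter, ← univ_product_univ, sum_product]
  rw [hcard, hsum, ← add_sum_erase _ _ (mem_univ (0 : F)),
    sum_congr rfl fun u hu => card_trace_mul_eq_zero hF (ne_of_mem_erase hu)]
  simp [hF, pow_succ, mul_comm]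

omit [DecidableEq F] [Algebra (ZMod 3) F] in
theorem not_isSquare_neg_one {m : ℕ} (hm : Even m) (hF : Fintype.card F = 3 ^ (m + 1)) :
    ¬ IsSquare (-1 : F) := by
  rw [FiniteField.isSquare_neg_one_iff, hF, not_not]
  obtain ⟨k, rfl⟩ := hm
  rw [pow_succ, ← two_mul, pow_mul, Nat.mul_mod, Nat.pow_mod]
  simp

theorem card_trace_sq_eq {m : ℕ} (hF : Fintype.card F = 3 ^ (m + 1)) (c : ZMod 3) :
    (#{y : F | Algebra.trace (ZMod 3) F (y ^ 2) = c} : ℤ) =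
      3 ^ m + ∑ z : F with Algebra.trace (ZMod 3) F z = c, quadraticChar F z := by
  have := charP_three (F := F)
  have h2 : ringChar F ≠ 2 := by rw [ringChar.eq F 3]; norm_num
  have hfib := card_eq_sum_card_fiberwise
    (s := {y : F | Algebra.trace (ZMod 3) F (y ^ 2) = c})
    (t := {z : F | Algebra.trace (ZMod 3) F z = c}) (f := fun y => y ^ 2)
    (fun y hy => by simpa using hy)
  rw [hfib, Nat.cast_sum]
  have hz : ∀ z ∈ ({z : F | Algebra.trace (ZMod 3) F z = c} : Finset F),
      (#{y ∈ {y : F | Algebra.trace (ZMod 3) F (y ^ 2) = c} | y ^ 2 = z} : ℤ) =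
        1 + quadraticChar F z := by
    intro z hz
    rw [add_comm, ← quadraticChar_card_sqrts h2, filter_filter]
    congr 2
    ext y
    simp only [mem_filter, mem_univ, true_and] at hz
    simp only [mem_filter, mem_univ, true_and, Set.mem_toFinset, Set.mem_ofPred_eq]
    exact ⟨fun h => h.2, fun h => ⟨by rw [h, hz], h⟩⟩
  rw [sum_congr rfl hz, sum_add_distrib]
  simp [card_trace_fiber hF]

theorem card_trace_sq_one_add_card_trace_sq_neg_one {m : ℕ} (hm : Even m)
    (hF : Fintype.card F = 3 ^ (m + 1)) :
    #{y : F | Algebra.trace (ZMod 3) F (y ^ 2) = 1} +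
      #{y : F | Algebra.trace (ZMod 3) F (y ^ 2) = -1} = 2 * 3 ^ m := by
  have hneg : ∑ z : F with Algebra.trace (ZMod 3) F z = -1, quadraticChar F z =
      -∑ z : F with Algebra.trace (ZMod 3) F z = 1, quadraticChar F z := by
    rw [← sum_neg_distrib]
    refine sum_equiv (Equiv.neg F) (fun z => ?_) fun z _ => ?_
    · simp [neg_eq_iff_eq_neg]
    · have h := quadraticChar_neg_one_iff_not_isSquare.2 (not_isSquare_neg_one hm hF)
      rw [Equiv.neg_apply, neg_eq_neg_one_mul z, map_mul, h]
      ring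
  zify
  rw [card_trace_sq_eq hF, card_trace_sq_eq hF, hneg]
  ring

/-- For odd `m + 1`, one of the two quadrics `Tr (y ^ 2) = ± 1` has `3 ^ m + 3 ^ (m / 2)` points. -/
theorem exists_card_trace_sq_add_ne_zero {m : ℕ} (hm : Even m)
    (hF : Fintype.card F = 3 ^ (m + 1)) :
    ∃ ε : ZMod 3, #{y : F | Algebra.trace (ZMod 3) F (y ^ 2) + ε ≠ 0} =
      2 * 3 ^ m - 3 ^ (m / 2) := by
  obtain ⟨k, rfl⟩ := hm
  rw [show (k + k) / 2 = k by omega]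
  set N : ZMod 3 → ℕ := fun c => #{y : F | Algebra.trace (ZMod 3) F (y ^ 2) = c} with hN
  have huniv : (univ : Finset (ZMod 3)) = {0, 1, -1} := by decide
  have hsum (f : ZMod 3 → ℕ) : ∑ c, f c = f 0 + f 1 + f (-1) := by
    rw [huniv, sum_insert (by decide), sum_insert (by decide), sum_singleton, add_assoc]
  have htotal : 3 * 3 ^ (k + k) = N 0 + N 1 + N (-1) := by
    rw [← hsum, ← pow_succ', ← hF, ← card_univ]
    exact card_eq_sum_card_fiberwise (by simp)
  have hpm : N 1 + N (-1) = 2 * 3 ^ (k + k) :=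
    card_trace_sq_one_add_card_trace_sq_neg_one ⟨k, rfl⟩ hF
  have hsq : N 0 ^ 2 + N 1 ^ 2 + N (-1) ^ 2 =
      3 * 3 ^ (k + k) + (3 * 3 ^ (k + k) - 1) * 3 ^ (k + k) := by
    rw [← card_trace_sq_eq_trace_sq hF, ← hsum fun c => N c ^ 2]
    rw [card_eq_sum_card_fiberwise (t := univ)
      (f := fun p : F × F => Algebra.trace (ZMod 3) F (p.1 ^ 2)) (by simp)]
    refine sum_congr rfl fun c _ => ?_
    rw [sq, hN, ← card_product]
    congr 1
    ext p
    simp only [mem_product, mem_filter, mem_univ, true_and]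
    constructor <;> rintro ⟨h₁, h₂⟩ <;> simp_all
  have hcompl (ε : ZMod 3) : N (-ε) +
      #{y : F | Algebra.trace (ZMod 3) F (y ^ 2) + ε ≠ 0} = 3 * 3 ^ (k + k) := by
    rw [← pow_succ', ← hF, ← card_univ, hN, ← card_filter_add_card_filter_not (s := univ)
      fun y : F => Algebra.trace (ZMod 3) F (y ^ 2) = -ε]
    simp only [add_eq_zero_iff_eq_neg, ne_eq]
  have hpos : 1 ≤ 3 * 3 ^ (k + k) := by have := Nat.one_le_pow (k + k) 3 (by norm_num); omega
  simp only [pow_add] at htotal hpm hsq hcompl hpos ⊢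
  have hr := Nat.one_le_pow k 3 (by norm_num)
  generalize 3 ^ k = r at *
  zify [hpos] at htotal hpm hsq
  have hfactor : ((N 1 : ℤ) - r * r - r) * (N 1 - r * r + r) = 0 := by
    have h0 : (N 0 : ℤ) = r * r := by linarith
    have h1 : (N (-1) : ℤ) = 2 * (r * r) - N 1 := by linarith
    rw [h0, h1] at hsq
    linarith
  rcases mul_eq_zero.1 hfactor with h | h
  · refine ⟨-1, ?_⟩
    have := hcompl (-1)
    rw [neg_neg] at this
    have : r * r + r = N 1 := by zify; linarith
    omega
  · refine ⟨1, ?_⟩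
    have : r * r + r = N (-1) := by zify; linarith
    have := hcompl 1
    omega

end TraceCounting

section BaseChange

variable {K L ι : Type*} [Field K] [Field L] [Algebra K L]

theorem LinearIndependent.algebraMap_comp_pi {κ : Type*} {b : κ → ι → K}
    (hb : LinearIndependent K b) :
    LinearIndependent L fun k (x : ι) => algebraMap K L (b k x) := by
  rw [linearIndependent_iff'] at hb ⊢
  intro s g hg k hk
  rw [← Module.forall_dual_apply_eq_zero_iff K]
  intro φ
  refine hb s (fun k => φ (g k)) (funext fun x => ?_) k hk
  have h := congrArg φ (congrFun hg x)
  simpa [← Algebra.smul_def, mul_comm (g _), mul_comm (φ (g _))] using h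

theorem finrank_span_algebraMap_image [Finite ι] (S : Set (ι → K)) :
    Module.finrank L (Submodule.span L ((fun v (x : ι) => algebraMap K L (v x)) '' S)) =
      Module.finrank K (Submodule.span K S) := by
  obtain ⟨b, hbS, hspan, hb⟩ := exists_linearIndependent K S
  have := hb.finite
  have := Fintype.ofFinite b
  let φ : (ι → K) →ₗ[K] (ι → L) := (Algebra.linearMap K L).compLeft ι
  have himage : Submodule.span L ((fun v (x : ι) => algebraMap K L (v x)) '' S) =
      Submodule.span L (Set.range fun (v : b) (x : ι) => algebraMap K L (v.1 x)) := by
    apply le_antisymm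
    · rw [Submodule.span_le]
      rintro _ ⟨v, hv, rfl⟩
      have hle : Submodule.span K b ≤ ((Submodule.span L
          (Set.range fun (v : b) (x : ι) => algebraMap K L (v.1 x))).restrictScalars K).comap φ :=
        Submodule.span_le.2 fun w hw => Submodule.subset_span ⟨⟨w, hw⟩, rfl⟩
      exact hle (hspan ▸ Submodule.subset_span hv)
    · refine Submodule.span_mono ?_
      rintro _ ⟨v, rfl⟩
      exact ⟨v, hbS v.2, rfl⟩
  rw [himage, finrank_span_eq_card (LinearIndependent.algebraMap_comp_pi hb), ← hspan,
    finrank_span_set_eq_card hb, Set.toFinset_card]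

end BaseChange

section TernaryDigits

/-- The number with ternary digits `f`. -/
def ternaryValue {m : ℕ} (f : Fin m → Fin 3) : ℕ := ∑ i, (f i : ℕ) * 3 ^ (i : ℕ)

/-- The ternary digit strings of length `m` with at most two nonzero digits. -/
def lowWeight (m : ℕ) : Finset (Fin m → Fin 3) := {f | #{i | f i ≠ 0} ≤ 2}

/-- The digit string with digit `a` in place `i` and digit `b` in place `j ≠ i`. -/
def twoDigits {m : ℕ} (i : Fin m) (a : Fin 3) (j : Fin m) (b : Fin 3) : Fin m → Fin 3 :=
  fun k => if k = i then a else if k = j then b else 0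

variable {m : ℕ}

theorem coe_finFunctionFinEquiv (f : Fin m → Fin 3) :
    (finFunctionFinEquiv f : ℕ) = ternaryValue f := finFunctionFinEquiv_apply f

theorem ternaryValue_lt (f : Fin m → Fin 3) : ternaryValue f < 3 ^ m :=
  coe_finFunctionFinEquiv f ▸ (finFunctionFinEquiv f).2

theorem ternaryValue_injective : Function.Injective (ternaryValue (m := m)) := by
  intro f g h
  rw [← coe_finFunctionFinEquiv, ← coe_finFunctionFinEquiv, Fin.val_inj] at h
  exact finFunctionFinEquiv.injective h

theorem ternaryValue_digit (f : Fin m → Fin 3) (i : Fin m) :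
    ternaryValue f / 3 ^ (i : ℕ) % 3 = f i := by
  conv_rhs => rw [← finFunctionFinEquiv.symm_apply_apply f]
  rw [← coe_finFunctionFinEquiv]
  rfl

theorem ternaryValue_lt_pred (f : Fin m → Fin 3) (hf : ∃ i, f i ≠ 2) :
    ternaryValue f < 3 ^ m - 1 := by
  obtain ⟨i, hi⟩ := hf
  have hlt : ternaryValue f < ternaryValue fun _ : Fin m => (2 : Fin 3) := by
    refine sum_lt_sum (fun k _ => ?_) ⟨i, mem_univ i, ?_⟩
    · exact Nat.mul_le_mul_right _ (by have := (f k).2; simp; omega)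
    · refine Nat.mul_lt_mul_of_pos_right ?_ (by positivity)
      exact (show ∀ a : Fin 3, a ≠ 2 → (a : ℕ) < (2 : Fin 3) by decide) _ hi
  have := ternaryValue_lt fun _ : Fin m => (2 : Fin 3)
  omega

theorem ternaryValue_twoDigits {i j : Fin m} (hij : i ≠ j) (a b : Fin 3) :
    ternaryValue (twoDigits i a j b) = a * 3 ^ (i : ℕ) + b * 3 ^ (j : ℕ) := by
  rw [ternaryValue, Fintype.sum_eq_add i j hij]
  · simp [twoDigits, hij.symm]
  · rintro k ⟨hi, hj⟩
    simp [twoDigits, hi, hj]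

theorem ternaryValue_single (i : Fin m) (a : Fin 3) :
    ternaryValue (Pi.single i a) = a * 3 ^ (i : ℕ) := by
  rw [← coe_finFunctionFinEquiv, finFunctionFinEquiv_single]

theorem ternaryValue_zero : ternaryValue (0 : Fin m → Fin 3) = 0 := by simp [ternaryValue]

theorem twoDigits_mem_lowWeight (i j : Fin m) (a b : Fin 3) : twoDigits i a j b ∈ lowWeight m := by
  simp only [lowWeight, mem_filter, mem_univ, true_and]
  refine (card_le_card (t := {i, j}) fun k hk => ?_).trans card_le_two
  by_contra h
  simp only [mem_insert, mem_singleton, not_or] at h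
  exact (mem_filter.1 hk).2 (by simp [twoDigits, h.1, h.2])

theorem single_mem_lowWeight (i : Fin m) (a : Fin 3) : Pi.single i a ∈ lowWeight m := by
  simp only [lowWeight, mem_filter, mem_univ, true_and]
  refine (card_le_card (t := {i}) fun k hk => ?_).trans (by simp)
  by_contra h
  simp_all

theorem exists_le_twoDigits (hm : 2 ≤ m) {f : Fin m → Fin 3} (hf : f ∈ lowWeight m) :
    ∃ i j, i ≠ j ∧ f ≤ twoDigits i 2 j 2 := by
  simp only [lowWeight, mem_filter, mem_univ, true_and] at hf
  obtain ⟨t, hft, ht⟩ := exists_superset_card_eq hf (by simpa using hm)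
  obtain ⟨i, j, hij, rfl⟩ := card_eq_two.1 ht
  refine ⟨i, j, hij, fun k => ?_⟩
  by_cases hk : f k = 0
  · simp [hk]
  · have := hft (mem_filter.2 ⟨mem_univ k, hk⟩)
    have h2 : twoDigits i 2 j 2 k = 2 := by
      rcases mem_insert.1 this with rfl | h
      · simp [twoDigits]
      · simp [twoDigits, mem_singleton.1 h]
    rw [h2]
    exact Fin.le_last (f k)

theorem card_lowWeight (hm : 2 ≤ m) : #(lowWeight m) = 2 * m ^ 2 + 1 := by
  let g : ℕ → ℕ := fun k => if k ≤ 2 then 2 ^ k else 0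
  have hfiber (S : Finset (Fin m)) :
      #{f ∈ lowWeight m | ({i | f i ≠ 0} : Finset (Fin m)) = S} = g #S := by
    by_cases hS : #S ≤ 2
    · have : {f ∈ lowWeight m | ({i | f i ≠ 0} : Finset (Fin m)) = S} =
          Fintype.piFinset fun i => if i ∈ S then ({1, 2} : Finset (Fin 3)) else {0} := by
        ext f
        have h12 : ∀ a : Fin 3, a ∈ ({1, 2} : Finset (Fin 3)) ↔ a ≠ 0 := by decide
        simp only [lowWeight, mem_filter, mem_univ, true_and, Fintype.mem_piFinset]
        constructor
        · rintro ⟨-, rfl⟩ i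
          by_cases hi : f i = 0 <;> simp [hi, -mem_insert, h12]
        · intro h
          have hSf : ({i | f i ≠ 0} : Finset (Fin m)) = S := by
            ext i
            have := h i
            split_ifs at this with hi <;> simp_all
          exact ⟨hSf ▸ hS, hSf⟩
      rw [this, Fintype.card_piFinset]
      have hcard (i : Fin m) : #(if i ∈ S then ({1, 2} : Finset (Fin 3)) else {0}) =
          if i ∈ S then 2 else 1 := by split_ifs <;> rfl
      simp [hcard, g, hS]
    · simp only [g, hS, if_false, card_eq_zero, filter_eq_empty_iff]
      rintro f hf rfl
      simp [lowWeight] at hf hS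
      omega
  rw [card_eq_sum_card_fiberwise (t := (univ : Finset (Fin m)).powerset)
    (f := fun f : Fin m → Fin 3 => ({i | f i ≠ 0} : Finset (Fin m))) (by simp),
    sum_congr rfl fun S _ => hfiber S, sum_powerset_apply_card, card_univ, Fintype.card_fin,
    ← sum_subset (range_subset_range.2 (by omega : 3 ≤ m + 1)) fun k _ hk => by
      simp only [mem_range] at hk; simp [g, show ¬ k ≤ 2 by omega]]
  simp only [sum_range_succ, range_zero, sum_empty, g]
  obtain ⟨n, rfl⟩ : ∃ n, m = n + 1 := ⟨m - 1, by omega⟩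
  simp [Nat.choose_two_right]
  have := Nat.div_mul_cancel (Nat.even_mul_succ_self n).two_dvd
  rw [mul_comm (n + 1) n]
  nlinarith

theorem choose_ternaryValue_ne_zero {f g : Fin m → Fin 3} (h : f ≤ g) :
    ((ternaryValue g).choose (ternaryValue f) : ZMod 3) ≠ 0 := by
  have hlucas := Choose.choose_modEq_prod_range_choose_nat (p := 3) (ternaryValue_lt g)
    (ternaryValue_lt f)
  rw [(ZMod.natCast_eq_natCast_iff _ _ _).2 hlucas, Nat.cast_prod, prod_ne_zero_iff]
  intro i hi
  rw [ternaryValue_digit g ⟨i, mem_range.1 hi⟩, ternaryValue_digit f ⟨i, mem_range.1 hi⟩]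
  exact (show ∀ a b : Fin 3, a ≤ b → (((b : ℕ).choose a : ℕ) : ZMod 3) ≠ 0 by decide) _ _ (h _)

end TernaryDigits

section Interpolation

open Polynomial

variable {F : Type*} [Field F] [Fintype F]

theorem linearIndependent_pow_of_injective {κ : Type*} [Fintype κ] {e : κ → ℕ}
    (he : Function.Injective e) (hlt : ∀ k, e k < Fintype.card F) :
    LinearIndependent F fun k (x : F) => x ^ e k := by
  classical
  rw [Fintype.linearIndependent_iff]
  intro g hg k
  set P : F[X] := ∑ k, C (g k) * X ^ e k with hP
  have heval (x : F) : P.eval x = 0 := by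
    simpa [hP, eval_finsetSum] using congrFun hg x
  have hdeg : P.natDegree < Fintype.card F := by
    refine (natDegree_sum_le_of_forall_le (n := Fintype.card F - 1) _ _ fun k _ =>
      (natDegree_C_mul_X_pow_le _ _).trans (Nat.le_sub_one_of_lt (hlt k))).trans_lt ?_
    exact Nat.sub_lt Fintype.card_pos one_pos
  have hzero : P = 0 := by
    by_contra h
    obtain ⟨x, hx⟩ := exists_eval_ne_zero_of_natDegree_lt_card P h (by simpa using hdeg)
    exact hx (heval x)
  have hcoeff := congrArg (fun p => coeff p (e k)) hzero
  simp only [hP, finsetSum_coeff, coeff_C_mul_X_pow, he.eq_iff, coeff_zero] at hcoeff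
  simpa using hcoeff

/-- A submodule of functions that contains all affine substitutions of `W` contains every power
occurring in one of them. -/
theorem pow_mem_of_eval_affine_mem [DecidableEq F] {W : F[X]}
    (hW : W.natDegree < Fintype.card F - 1) {e : ℕ} (he : hasseDeriv e W ≠ 0)
    {T : Submodule F (F → F)}
    (hT : ∀ s t : F, s ≠ 0 → (fun x => W.eval (s * x + t)) ∈ T) : (fun x : F => x ^ e) ∈ T := by
  set q := Fintype.card F with hq
  have heq : e < q - 1 := by
    refine lt_of_not_ge fun h => he ?_
    exact hasseDeriv_eq_zero_of_lt_natDegree W e (hW.trans_le h)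
  obtain ⟨t, ht⟩ := exists_eval_ne_zero_of_natDegree_lt_card (hasseDeriv e W) he (by
    have := (natDegree_hasseDeriv_le W e).trans_lt ((Nat.sub_le _ _).trans_lt hW)
    simpa using this.trans_le (Nat.sub_le _ _))
  have hexpand (y : F) : W.eval (y + t) =
      ∑ k ∈ Finset.range (q - 1), (hasseDeriv k W).eval t * y ^ k := by
    rw [← taylor_eval, eval_eq_sum_range' (by rwa [natDegree_taylor])]
    simp only [taylor_coeff]
  have hsum : ∑ s : Fˣ, (s : F) ^ (q - 1 - e) • (fun x => W.eval (s * x + t)) ∈ T :=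
    T.sum_mem fun s _ => T.smul_mem _ (hT s t s.ne_zero)
  have horth : ∑ s : Fˣ, (s : F) ^ (q - 1 - e) • (fun x => W.eval (s * x + t)) =
      (-(hasseDeriv e W).eval t) • fun x => x ^ e := by
    ext x
    simp only [Finset.sum_apply, Pi.smul_apply, smul_eq_mul, hexpand, Finset.mul_sum]
    rw [Finset.sum_comm, Finset.sum_eq_single_of_mem e (Finset.mem_range.2 heq)]
    · have h : ∀ s : Fˣ, (s : F) ^ (q - 1 - e) * ((hasseDeriv e W).eval t * (s * x) ^ e) =
          ((hasseDeriv e W).eval t * x ^ e) * (s : F) ^ (q - 1) := fun s => by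
        rw [← Nat.sub_add_cancel heq.le, pow_add, Nat.add_sub_cancel, mul_pow]; ring
      rw [Finset.sum_congr rfl fun s _ => h s, ← Finset.mul_sum, FiniteField.sum_pow_units]
      simp [hq]
    · intro k hk hke
      rw [Finset.mem_range] at hk
      have h : ∀ s : Fˣ, (s : F) ^ (q - 1 - e) * ((hasseDeriv k W).eval t * (s * x) ^ k) =
          ((hasseDeriv k W).eval t * x ^ k) * (s : F) ^ (q - 1 - e + k) := fun s => by
        rw [pow_add, mul_pow]; ring
      rw [Finset.sum_congr rfl fun s _ => h s, ← Finset.mul_sum, FiniteField.sum_pow_units,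
        if_neg, mul_zero]
      rintro ⟨c, hc⟩
      rw [← hq] at hc
      rcases c with _ | _ | c
      · omega
      · omega
      · have : (q - 1) * 2 ≤ (q - 1) * (c + 1 + 1) := Nat.mul_le_mul_left _ (by omega)
        omega
  rw [horth] at hsum
  exact (T.smul_mem_iff (neg_ne_zero.2 ht)).1 hsum

end Interpolation

section LowWeightMonomials

variable {F : Type} [Field F]

/-- The functions on `F` spanned by the powers whose exponent has at most two nonzero ternary
digits. -/
def lowWeightSpan (F : Type) [Field F] (m : ℕ) : Submodule F (F → F) :=
  Submodule.span F (Set.range fun (f : lowWeight m) (x : F) => x ^ ternaryValue f.1)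

variable {n : ℕ}

theorem pow_mem_lowWeightSpan {m : ℕ} {f : Fin m → Fin 3} (hf : f ∈ lowWeight m) {g : F → F}
    (hg : ∀ x, g x = x ^ ternaryValue f) : g ∈ lowWeightSpan F m :=
  Submodule.subset_span ⟨⟨f, hf⟩, (funext hg).symm⟩

/-- Cubing shifts ternary digits cyclically. -/
theorem pow_three_pow_add_one [Fintype F] (hF : Fintype.card F = 3 ^ (n + 1)) (i : Fin (n + 1))
    (x : F) : x ^ 3 ^ ((i + 1 : Fin (n + 1)) : ℕ) = x ^ (3 * 3 ^ (i : ℕ)) := by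
  rcases eq_or_ne i (Fin.last n) with rfl | hi
  · rw [Fin.last_add_one, Fin.val_last, ← pow_succ', ← hF, FiniteField.pow_card]
    simp
  · rw [Fin.val_add_one_of_lt (Fin.lt_last_iff_ne_last.2 hi), pow_succ']

theorem ne_add_one {n : ℕ} (hn : 1 ≤ n) (i : Fin (n + 1)) : i ≠ i + 1 := by
  have : NeZero n := ⟨by omega⟩
  intro h
  simp at h

theorem pow_add_pow_mem_lowWeightSpan [Fintype F] (hn : 1 ≤ n)
    (hF : Fintype.card F = 3 ^ (n + 1)) (i j : Fin (n + 1)) (a b : Fin 3) :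
    (fun x : F => x ^ ((a : ℕ) * 3 ^ (i : ℕ) + b * 3 ^ (j : ℕ))) ∈ lowWeightSpan F (n + 1) := by
  rcases eq_or_ne i j with rfl | hij
  · have hlow (c : Fin 3) (hc : (c : ℕ) = a + b) :
        (fun x : F => x ^ ((a : ℕ) * 3 ^ (i : ℕ) + b * 3 ^ (i : ℕ))) ∈ lowWeightSpan F (n + 1) :=
      pow_mem_lowWeightSpan (single_mem_lowWeight i c) fun x => by
        rw [ternaryValue_single, hc, add_mul]
    by_cases h3 : (a : ℕ) + b < 3
    · exact hlow ⟨a + b, h3⟩ rfl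
    · obtain ⟨c, hc⟩ : ∃ c : Fin 3, (a : ℕ) + b = c + 3 := ⟨⟨a + b - 3, by omega⟩, by simp; omega⟩
      refine pow_mem_lowWeightSpan
        (twoDigits_mem_lowWeight i (i + 1) c 1) fun x => ?_
      rw [ternaryValue_twoDigits (ne_add_one hn i), ← add_mul, hc, pow_add, add_mul, pow_add]
      simp [pow_three_pow_add_one hF]
  · exact pow_mem_lowWeightSpan (twoDigits_mem_lowWeight i j a b) fun x => by
      rw [ternaryValue_twoDigits hij]

theorem finrank_lowWeightSpan [Fintype F] {m : ℕ} (hm : 2 ≤ m) (hF : Fintype.card F = 3 ^ m) :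
    Module.finrank F (lowWeightSpan F m) = 2 * m ^ 2 + 1 := by
  have hli : LinearIndependent F fun (f : lowWeight m) (x : F) => x ^ ternaryValue f.1 :=
    linearIndependent_pow_of_injective (ternaryValue_injective.comp Subtype.val_injective)
      fun f => hF ▸ ternaryValue_lt f.1
  rw [lowWeightSpan, finrank_span_eq_card hli, Fintype.card_coe, card_lowWeight hm]

end LowWeightMonomials

section Trace

open scoped Pointwise

variable {F : Type} [Field F] [Fintype F] [Algebra (ZMod 3) F] {n : ℕ}

theorem algebraMap_trace (hF : Fintype.card F = 3 ^ (n + 1)) (x : F) :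
    algebraMap (ZMod 3) F (Algebra.trace (ZMod 3) F x) =
      ∑ i : Fin (n + 1), x ^ 3 ^ (i : ℕ) := by
  have hrank : Module.finrank (ZMod 3) F = n + 1 := by
    have := Module.card_eq_pow_finrank (K := ZMod 3) (V := F)
    rw [hF, ZMod.card] at this
    exact (Nat.pow_right_injective (by norm_num : 2 ≤ 3) this).symm
  rw [FiniteField.algebraMap_trace_eq_sum_pow, hrank, Nat.card_zmod, sum_range]

omit [Fintype F] in
theorem algebraMap_indicator (c : ZMod 3) :
    algebraMap (ZMod 3) F (if c ≠ 0 then 1 else 0) = algebraMap (ZMod 3) F c ^ 2 := by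
  rw [← map_pow]
  congr 1
  revert c
  decide

theorem quadratic_sq_mem_lowWeightSpan (hn : 1 ≤ n) (hF : Fintype.card F = 3 ^ (n + 1)) (a b : F)
    (h : ZMod 3) :
    (fun x => algebraMap (ZMod 3) F (Algebra.trace (ZMod 3) F (a * x ^ 2 + b * x) + h) ^ 2) ∈
      lowWeightSpan F (n + 1) := by
  let S : Set (F → F) := Set.range fun (p : Fin (n + 1) × Fin 3) (x : F) =>
    x ^ ((p.2 : ℕ) * 3 ^ (p.1 : ℕ))
  have hc : (fun x => algebraMap (ZMod 3) F (Algebra.trace (ZMod 3) F (a * x ^ 2 + b * x) + h)) ∈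
      Submodule.span F S := by
    have heq : (fun x => algebraMap (ZMod 3) F
        (Algebra.trace (ZMod 3) F (a * x ^ 2 + b * x) + h)) =
        ∑ i : Fin (n + 1), (a ^ 3 ^ (i : ℕ) • (fun x : F => x ^ (((2 : Fin 3) : ℕ) * 3 ^ (i : ℕ))) +
          b ^ 3 ^ (i : ℕ) • (fun x : F => x ^ (((1 : Fin 3) : ℕ) * 3 ^ (i : ℕ)))) +
        algebraMap (ZMod 3) F h •
          (fun x : F => x ^ (((0 : Fin 3) : ℕ) * 3 ^ ((0 : Fin (n + 1)) : ℕ))) := by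
      ext x
      simp [algebraMap_trace hF, mul_pow, pow_mul, sum_add_distrib, Algebra.smul_def]
    rw [heq]
    have hmem (i : Fin (n + 1)) (k : Fin 3) :
        (fun x : F => x ^ ((k : ℕ) * 3 ^ (i : ℕ))) ∈ Submodule.span F S :=
      Submodule.subset_span ⟨(i, k), rfl⟩
    exact add_mem (sum_mem fun i _ => add_mem (Submodule.smul_mem _ _ (hmem _ _))
      (Submodule.smul_mem _ _ (hmem _ _))) (Submodule.smul_mem _ _ (hmem _ _))
  have hmul := Submodule.mul_mem_mul hc hc
  rw [Submodule.span_mul_span] at hmul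
  have hle : Submodule.span F (S * S) ≤ lowWeightSpan F (n + 1) := by
    rw [Submodule.span_le]
    rintro _ ⟨_, ⟨⟨i, k⟩, rfl⟩, _, ⟨⟨j, l⟩, rfl⟩, rfl⟩
    have heq : (fun x : F => x ^ ((k : ℕ) * 3 ^ (i : ℕ))) * (fun x => x ^ ((l : ℕ) * 3 ^ (j : ℕ))) =
        fun x => x ^ ((k : ℕ) * 3 ^ (i : ℕ) + l * 3 ^ (j : ℕ)) := by
      ext x
      simp [pow_add]
    change _ * _ ∈ lowWeightSpan F (n + 1)
    rw [heq]
    exact pow_add_pow_mem_lowWeightSpan hn hF i j k l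
  convert hle hmul using 1
  ext x
  simp [sq]

open Polynomial

/-- The ternary digits of `2 * 3 ^ k + 2 * 3 ^ l`, reduced modulo `3 ^ (n + 1) - 1`. -/
def squareDigits (k l : Fin (n + 1)) : Fin (n + 1) → Fin 3 :=
  if k = l then twoDigits k 1 (k + 1) 1 else twoDigits k 2 l 2

/-- The reduced polynomial of the function `(Tr (y ^ 2) + ε) ^ 2`. -/
noncomputable def squarePoly (F : Type) [Field F] [Algebra (ZMod 3) F] (n : ℕ) (ε : ZMod 3) :
    F[X] :=
  (∑ k : Fin (n + 1), ∑ l : Fin (n + 1), X ^ ternaryValue (squareDigits k l)) +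
    (∑ k : Fin (n + 1), C (algebraMap (ZMod 3) F (2 * ε)) *
      X ^ ternaryValue (Pi.single k 2 : Fin (n + 1) → Fin 3)) +
    C (algebraMap (ZMod 3) F (ε ^ 2)) * X ^ ternaryValue (0 : Fin (n + 1) → Fin 3)

theorem eval_squarePoly (hn : 1 ≤ n) (hF : Fintype.card F = 3 ^ (n + 1)) (ε : ZMod 3) (y : F) :
    (squarePoly F n ε).eval y =
      algebraMap (ZMod 3) F (Algebra.trace (ZMod 3) F (y ^ 2) + ε) ^ 2 := by
  have hpow (k l : Fin (n + 1)) : y ^ ternaryValue (squareDigits k l) =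
      (y ^ 2) ^ 3 ^ (k : ℕ) * (y ^ 2) ^ 3 ^ (l : ℕ) := by
    rw [squareDigits]
    split_ifs with h
    · subst h
      rw [ternaryValue_twoDigits (ne_add_one hn k), pow_add]
      simp only [Fin.val_one, one_mul, pow_three_pow_add_one hF]
      ring
    · rw [ternaryValue_twoDigits h, pow_add]
      simp [pow_mul]
  have h2 : algebraMap (ZMod 3) F 2 = 2 := map_ofNat _ 2
  simp only [squarePoly, eval_add, eval_finsetSum, eval_mul, eval_C, eval_pow, eval_X, hpow,
    ternaryValue_single, ternaryValue_zero, map_add, algebraMap_trace hF,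
    ← mul_sum, map_mul, map_pow, pow_zero, eval_one, h2, Fin.val_two, pow_mul, ← sum_mul]
  ring

omit [Fintype F] in
theorem coeff_squarePoly (ε : ZMod 3) {i j : Fin (n + 1)} (hij : i ≠ j) :
    (squarePoly F n ε).coeff (ternaryValue (twoDigits i 2 j 2)) = 2 := by
  have hsq (k l : Fin (n + 1)) : twoDigits i 2 j 2 = squareDigits k l ↔
      (k = i ∧ l = j) ∨ (k = j ∧ l = i) := by
    constructor
    · intro h
      have hi := congrFun h i
      have hj := congrFun h j
      simp only [squareDigits] at hi hj
      split_ifs at hi hj with hkl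
      · have hne : ∀ x, twoDigits k 1 (k + 1) 1 x ≠ 2 := fun x => by
          rw [twoDigits]; split_ifs <;> decide
        exact absurd hi.symm (by simpa [twoDigits] using hne i)
      · simp only [twoDigits, hij.symm, if_true, if_false] at hi hj
        grind
    · rintro (⟨rfl, rfl⟩ | ⟨rfl, rfl⟩)
      · simp [squareDigits, hij]
      · ext x
        simp only [squareDigits, hij.symm, if_false, twoDigits]
        split_ifs <;> rfl
  have hsingle (k : Fin (n + 1)) : twoDigits i 2 j 2 ≠ Pi.single k 2 := fun h => by
    have hi := congrFun h i
    have hj := congrFun h j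
    simp only [twoDigits, hij.symm, if_true, if_false, Pi.single_apply] at hi hj
    grind
  have hzero : twoDigits i 2 j 2 ≠ 0 := fun h => by
    simpa [twoDigits] using congrFun h i
  simp only [squarePoly, coeff_add, finsetSum_coeff, coeff_C_mul_X_pow, coeff_X_pow,
    ternaryValue_injective.eq_iff, hsq, hsingle, hzero, if_false, sum_const_zero, add_zero]
  rw [← sum_product', univ_product_univ, sum_boole]
  have hfilter : ({p | p.1 = i ∧ p.2 = j ∨ p.1 = j ∧ p.2 = i} :
      Finset (Fin (n + 1) × Fin (n + 1))) = {(i, j), (j, i)} := by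
    ext ⟨k, l⟩
    simp
  rw [hfilter, card_pair fun h => hij (congrArg Prod.fst h), Nat.cast_ofNat]

omit [Fintype F] in
theorem natDegree_squarePoly_lt (hn : 2 ≤ n) (ε : ZMod 3) :
    (squarePoly F n ε).natDegree < 3 ^ (n + 1) - 1 := by
  have hlow {f : Fin (n + 1) → Fin 3} (hf : f ∈ lowWeight (n + 1)) :
      ternaryValue f ≤ 3 ^ (n + 1) - 2 := by
    have := ternaryValue_lt_pred f (by
      by_contra! h
      simp [lowWeight, h] at hf
      omega)
    omega
  have hsq (k l : Fin (n + 1)) : squareDigits k l ∈ lowWeight (n + 1) := by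
    rw [squareDigits]
    split_ifs <;> exact twoDigits_mem_lowWeight _ _ _ _
  have hpos : 3 ^ 1 ≤ 3 ^ (n + 1) := Nat.pow_le_pow_right (by norm_num) (by omega)
  refine (natDegree_add_le_of_degree_le (natDegree_add_le_of_degree_le ?_ ?_) ?_).trans_lt
    (by omega : 3 ^ (n + 1) - 2 < 3 ^ (n + 1) - 1)
  · exact natDegree_sum_le_of_forall_le _ _ fun k _ => natDegree_sum_le_of_forall_le _ _ fun l _ =>
      (natDegree_X_pow_le _).trans (hlow (hsq k l))
  · exact natDegree_sum_le_of_forall_le _ _ fun k _ =>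
      (natDegree_C_mul_X_pow_le _ _).trans (hlow (single_mem_lowWeight k 2))
  · exact (natDegree_C_mul_X_pow_le _ _).trans (by rw [ternaryValue_zero]; omega)

end Trace

/-- for odd `m ≥ 5`, the `GF(3)`-dimension of the code spanned by the
incidence vectors of the supports of the minimum-weight codewords of `C(m,3)`
(the 3-rank of the incidence matrix of the design `D_d(C(m,3))`) equals `2m² + 1`. -/
theorem dim_code_of_design (m : ℕ) (hm : 5 ≤ m) (hmodd : Odd m)
    (F : Type) [Field F] [Fintype F] [DecidableEq F] [Algebra (ZMod 3) F]
    (hF : Fintype.card F = 3 ^ m) :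
    Module.finrank (ZMod 3)
      (Submodule.span (ZMod 3)
        {v : F → ZMod 3 | ∃ c : F → ZMod 3,
          (∃ a b : F, ∃ h : ZMod 3,
            c = fun x => Algebra.trace (ZMod 3) F (a * x ^ 2 + b * x) + h) ∧
          (Finset.univ.filter fun x : F => c x ≠ 0).card =
            2 * 3 ^ (m - 1) - 3 ^ ((m - 1) / 2) ∧
          v = fun x => if c x ≠ 0 then 1 else 0}) = 2 * m ^ 2 + 1 := by
  obtain ⟨n, rfl⟩ : ∃ n, m = n + 1 := ⟨m - 1, by omega⟩
  rw [Nat.add_sub_cancel]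
  rw [← finrank_span_algebraMap_image (L := F), ← finrank_lowWeightSpan (by omega) hF]
  refine congrArg (fun U : Submodule F (F → F) => Module.finrank F U) (le_antisymm ?_ ?_)
  · rw [Submodule.span_le]
    rintro _ ⟨_, ⟨_, ⟨a, b, h, rfl⟩, -, rfl⟩, rfl⟩
    simp only [algebraMap_indicator]
    exact quadratic_sq_mem_lowWeightSpan (by omega) hF a b h
  · obtain ⟨ε, hε⟩ := exists_card_trace_sq_add_ne_zero (m := n) (by
      rcases hmodd with ⟨k, hk⟩; exact ⟨k, by omega⟩) hF
    rw [lowWeightSpan, Submodule.span_le]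
    rintro _ ⟨⟨f, hf⟩, rfl⟩
    obtain ⟨i, j, hij, hle⟩ := exists_le_twoDigits (by omega) hf
    have hchoose := choose_ternaryValue_ne_zero hle
    refine pow_mem_of_eval_affine_mem (W := squarePoly F n ε)
      (hF ▸ natDegree_squarePoly_lt (by omega) ε) (fun h => ?_) fun s t hs => ?_
    · have hval : ternaryValue f ≤ ternaryValue (twoDigits i 2 j 2) := by
        by_contra h
        exact hchoose (by rw [Nat.choose_eq_zero_of_lt (not_le.1 h), Nat.cast_zero])
      have hcoeff := congrArg
        (fun p => p.coeff (ternaryValue (twoDigits i 2 j 2) - ternaryValue f)) h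
      simp only [Polynomial.hasseDeriv_coeff, Nat.sub_add_cancel hval,
        coeff_squarePoly ε hij, Polynomial.coeff_zero, mul_eq_zero] at hcoeff
      rcases hcoeff with h | h
      · exact hchoose ((algebraMap (ZMod 3) F).injective (by simpa using h))
      · have h2 : algebraMap (ZMod 3) F 2 = algebraMap (ZMod 3) F 0 :=
          (map_ofNat _ 2).trans (h.trans (map_zero _).symm)
        exact absurd ((algebraMap (ZMod 3) F).injective h2) (by decide)
    · refine Submodule.subset_span ⟨fun x =>
        if Algebra.trace (ZMod 3) F ((s * x + t) ^ 2) + ε ≠ 0 then 1 else 0,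
        ⟨fun x => Algebra.trace (ZMod 3) F ((s * x + t) ^ 2) + ε,
          ⟨s ^ 2, 2 * s * t, Algebra.trace (ZMod 3) F (t ^ 2) + ε, ?_⟩, ?_, rfl⟩, ?_⟩
      · ext x
        rw [← add_assoc, ← map_add]
        congr 2
        ring
      · rw [← hε]
        exact card_equiv ((Equiv.mulLeft₀ s hs).trans (Equiv.addRight t)) (by simp)
      · ext x
        rw [eval_squarePoly (by omega) hF]
        exact algebraMap_indicator _
end
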